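/- arXiv:2211.06938 — 2 statements merged into one kernel-verified Lean document; each statement's English description precedes it below -/
import Mathlib

section
/- Every special Heisenberg Lie superalgebra has trivial Bogomolov multiplier: B̃₀(H(m,n)) = 0 for all m, n with m + n ≥ 1. -/
/-!
Basic definitions for Lie superalgebras over a commutative ring `K`,
graded ideals, the nonabelian (CP) exterior products and the Bogomolov multiplier.
-/

universe u v

namespace BogomolovSuper

/-- The sign `(-1)^{|i||j|}` attached to a pair of `ℤ₂`-degrees. -/
def sgn (i j : ZMod 2) : ℤ := (-1) ^ (i.val * j.val)

/-- A Lie superalgebra structure on a `K`-module `L`: a `ℤ₂`-grading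
`gr` with `L = gr 0 ⊕ gr 1` together with a super bracket satisfying
super skew-symmetry, the super Jacobi identity and `[x,x] = 0` for even `x`. -/
structure SuperAlg (K : Type u) [CommRing K] (L : Type v)
    [AddCommGroup L] [Module K L] where
  bk : L →ₗ[K] L →ₗ[K] L
  gr : ZMod 2 → Submodule K L
  gr_inf : gr 0 ⊓ gr 1 = ⊥
  gr_sup : gr 0 ⊔ gr 1 = ⊤
  bk_gr : ∀ i j : ZMod 2, ∀ x ∈ gr i, ∀ y ∈ gr j, bk x y ∈ gr (i + j)
  skew : ∀ i j : ZMod 2, ∀ x ∈ gr i, ∀ y ∈ gr j, bk x y = -(sgn i j • bk y x)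
  jacobi : ∀ i j : ZMod 2, ∀ x ∈ gr i, ∀ y ∈ gr j, ∀ z : L,
    bk x (bk y z) = bk (bk x y) z + sgn i j • bk y (bk x z)
  even_sq : ∀ x ∈ gr 0, bk x x = 0

variable {K : Type u} [CommRing K]

section Defs

variable {L L' E : Type v} [AddCommGroup L] [Module K L]
  [AddCommGroup L'] [Module K L'] [AddCommGroup E] [Module K E]

/-- A homomorphism of Lie superalgebras of even degree (degree zero). -/
def IsSuperHom (s : SuperAlg K L) (s' : SuperAlg K L') (f : L →ₗ[K] L') : Prop :=
  (∀ x y : L, f (s.bk x y) = s'.bk (f x) (f y)) ∧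
  (∀ i : ZMod 2, ∀ x ∈ s.gr i, f x ∈ s'.gr i)

/-- A graded (homogeneous) ideal of a Lie superalgebra. -/
def IsGradedIdeal (s : SuperAlg K L) (M : Submodule K L) : Prop :=
  (∀ x : L, ∀ m ∈ M, s.bk x m ∈ M ∧ s.bk m x ∈ M) ∧
  (∀ m ∈ M, ∃ m₀ ∈ M ⊓ s.gr 0, ∃ m₁ ∈ M ⊓ s.gr 1, m = m₀ + m₁)

/-- The sub-Lie-superalgebra generated by a set: the smallest submodule
containing the set and closed under the bracket. -/
def lieSpan (s : SuperAlg K E) (S : Set E) : Submodule K E :=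
  sInf {p : Submodule K E | S ⊆ p ∧ ∀ x ∈ p, ∀ y ∈ p, s.bk x y ∈ p}

/-- `K(L)`: the set of all brackets `[a,b]`. -/
def bkSet (s : SuperAlg K L) : Set L := {x : L | ∃ a b : L, x = s.bk a b}

/-- The derived subalgebra `L² = [L,L]` (as a submodule; it is a graded ideal). -/
def derived (s : SuperAlg K L) : Submodule K L := Submodule.span K (bkSet s)

/-- The descending central series of a Lie superalgebra. -/
def lcs (s : SuperAlg K L) : ℕ → Submodule K L
  | 0 => ⊤
  | n + 1 => Submodule.span K {x : L | ∃ a ∈ lcs s n, ∃ b : L, x = s.bk a b}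

/-- Nilpotency of a Lie superalgebra. -/
def IsNilpotentSuper (s : SuperAlg K L) : Prop := ∃ c : ℕ, lcs s c = ⊥

/-- A Lie super exterior pairing on a pair of graded ideals `M`, `N` of `(L, s)`,
with values in a Lie superalgebra `(E, t)`. -/
structure IsExtPairing (s : SuperAlg K L) (M N : Submodule K L)
    (t : SuperAlg K E) (ρ : L → L → E) : Prop where
  grade : ∀ i j : ZMod 2, ∀ m ∈ M ⊓ s.gr i, ∀ n ∈ N ⊓ s.gr j, ρ m n ∈ t.gr (i + j)
  smul_left : ∀ (c : K) (i j : ZMod 2), ∀ m ∈ M ⊓ s.gr i, ∀ n ∈ N ⊓ s.gr j,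
    ρ (c • m) n = c • ρ m n
  smul_right : ∀ (c : K) (i j : ZMod 2), ∀ m ∈ M ⊓ s.gr i, ∀ n ∈ N ⊓ s.gr j,
    ρ m (c • n) = c • ρ m n
  add_left : ∀ (i j : ZMod 2), ∀ m ∈ M ⊓ s.gr i, ∀ m' ∈ M ⊓ s.gr i, ∀ n ∈ N ⊓ s.gr j,
    ρ (m + m') n = ρ m n + ρ m' n
  add_right : ∀ (i j : ZMod 2), ∀ m ∈ M ⊓ s.gr i, ∀ n ∈ N ⊓ s.gr j, ∀ n' ∈ N ⊓ s.gr j,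
    ρ m (n + n') = ρ m n + ρ m n'
  bk_left : ∀ (i i' j : ZMod 2), ∀ m ∈ M ⊓ s.gr i, ∀ m' ∈ M ⊓ s.gr i', ∀ n ∈ N ⊓ s.gr j,
    ρ (s.bk m m') n = ρ m (s.bk m' n) - sgn i i' • ρ m' (s.bk m n)
  bk_right : ∀ (i j j' : ZMod 2), ∀ m ∈ M ⊓ s.gr i, ∀ n ∈ N ⊓ s.gr j, ∀ n' ∈ N ⊓ s.gr j',
    ρ m (s.bk n n') = sgn j' (i + j) • ρ (s.bk n' m) n - sgn i j • ρ (s.bk n m) n'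
  bk_pair : ∀ (i j i' j' : ZMod 2), ∀ m ∈ M ⊓ s.gr i, ∀ n ∈ N ⊓ s.gr j,
    ∀ m' ∈ M ⊓ s.gr i', ∀ n' ∈ N ⊓ s.gr j',
    t.bk (ρ m n) (ρ m' n') = -(sgn i j • ρ (s.bk n m) (s.bk m' n'))

/-- A Lie super `B̃₀`-pairing: an exterior pairing that moreover kills the
commutativity-preserving relations. -/
structure IsB0Pairing (s : SuperAlg K L) (M N : Submodule K L)
    (t : SuperAlg K E) (ρ : L → L → E)
    extends IsExtPairing s M N t ρ : Prop where
  rel_pair : ∀ (i j i' j' : ZMod 2), ∀ m ∈ M ⊓ s.gr i, ∀ n ∈ N ⊓ s.gr j,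
    ∀ m' ∈ M ⊓ s.gr i', ∀ n' ∈ N ⊓ s.gr j',
    s.bk m n + sgn i' j' • s.bk m' n' = 0 → ρ m n + sgn i' j' • ρ m' n' = 0
  rel_even : ∀ m ∈ M ⊓ s.gr 0, ∀ n ∈ N ⊓ s.gr 0, s.bk m n = 0 → ρ m n = 0

/-- The set of wedge generators `m ∧ n` (`m`, `n` homogeneous). -/
def wedgeSet (s : SuperAlg K L) (M N : Submodule K L) (ρ : L → L → E) : Set E :=
  {e : E | ∃ i j : ZMod 2, ∃ m ∈ M ⊓ s.gr i, ∃ n ∈ N ⊓ s.gr j, e = ρ m n}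

/-- `(E, t, ρ)` is the nonabelian exterior product `M ∧ N`: `ρ` is a universal
exterior pairing whose image generates `E`. -/
structure IsExtProduct (s : SuperAlg K L) (M N : Submodule K L)
    (t : SuperAlg K E) (ρ : L → L → E) : Prop where
  pairing : IsExtPairing s M N t ρ
  gen : Submodule.span K (wedgeSet s M N ρ) = ⊤
  lift : ∀ {E' : Type v} [AddCommGroup E'] [Module K E'],
    ∀ (t' : SuperAlg K E') (ρ' : L → L → E'), IsExtPairing s M N t' ρ' →
    ∃ f : E →ₗ[K] E', IsSuperHom t t' f ∧
      ∀ (i j : ZMod 2), ∀ m ∈ M ⊓ s.gr i, ∀ n ∈ N ⊓ s.gr j, f (ρ m n) = ρ' m n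

/-- `(E, t, ρ)` is the commutativity preserving (CP) exterior product `M ⋏ N`:
`ρ` is a universal `B̃₀`-pairing whose image generates `E`. -/
structure IsCPProduct (s : SuperAlg K L) (M N : Submodule K L)
    (t : SuperAlg K E) (ρ : L → L → E) : Prop where
  pairing : IsB0Pairing s M N t ρ
  gen : Submodule.span K (wedgeSet s M N ρ) = ⊤
  lift : ∀ {E' : Type v} [AddCommGroup E'] [Module K E'],
    ∀ (t' : SuperAlg K E') (ρ' : L → L → E'), IsB0Pairing s M N t' ρ' →
    ∃ f : E →ₗ[K] E', IsSuperHom t t' f ∧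
      ∀ (i j : ZMod 2), ∀ m ∈ M ⊓ s.gr i, ∀ n ∈ N ⊓ s.gr j, f (ρ m n) = ρ' m n

/-- Generators of `M₀(M,N)` inside the exterior product. -/
def M0Set (s : SuperAlg K L) (M N : Submodule K L) (ρ : L → L → E) : Set E :=
  {e : E | ∃ i j i' j' : ZMod 2, ∃ m ∈ M ⊓ s.gr i, ∃ n ∈ N ⊓ s.gr j,
      ∃ m' ∈ M ⊓ s.gr i', ∃ n' ∈ N ⊓ s.gr j',
      s.bk m n + sgn i' j' • s.bk m' n' = 0 ∧ e = ρ m n + sgn i' j' • ρ m' n'} ∪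
  {e : E | ∃ m ∈ M ⊓ s.gr 0, ∃ n ∈ N ⊓ s.gr 0, s.bk m n = 0 ∧ e = ρ m n}

/-- `M₀(M,N)`, the graded submodule of the exterior product generated
by the commutativity-preserving relations. -/
def M0 (s : SuperAlg K L) (M N : Submodule K L) (ρ : L → L → E) : Submodule K E :=
  Submodule.span K (M0Set s M N ρ)

/-- `κ` is the commutator map `κ̃ : m ∧ n ↦ [m,n]`. -/
def IsCommMap (s : SuperAlg K L) (M N : Submodule K L) (ρ : L → L → E)
    (κ : E →ₗ[K] L) : Prop :=
  ∀ (i j : ZMod 2), ∀ m ∈ M ⊓ s.gr i, ∀ n ∈ N ⊓ s.gr j, κ (ρ m n) = s.bk m n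

/-- The Bogomolov multiplier `B̃₀(L) = M(L)/M₀(L)` of `(L,s)` is trivial:
for any realization of the exterior product `L ∧ L` and of the commutator
map `κ̃`, the kernel `M(L)` of `κ̃` is contained in `M₀(L)`. -/
def HasTrivialBog (s : SuperAlg K L) : Prop :=
  ∀ {E' : Type v} [AddCommGroup E'] [Module K E'],
    ∀ (t : SuperAlg K E') (w : L → L → E'), IsExtProduct s ⊤ ⊤ t w →
    ∀ κ : E' →ₗ[K] L, IsCommMap s ⊤ ⊤ w κ → LinearMap.ker κ ≤ M0 s ⊤ ⊤ w

end Defs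

section Free

variable {F : Type v} [AddCommGroup F] [Module K F]

/-- `(F, sF)` is the free Lie superalgebra on the `ℤ₂`-graded set `X`. -/
structure IsFreeSuper (sF : SuperAlg K F) (X : ZMod 2 → Set F) : Prop where
  subset : ∀ i : ZMod 2, X i ⊆ sF.gr i
  gen : lieSpan sF (X 0 ∪ X 1) = ⊤
  lift : ∀ {M : Type v} [AddCommGroup M] [Module K M],
    ∀ (sM : SuperAlg K M) (f : F → M), (∀ i : ZMod 2, ∀ x ∈ X i, f x ∈ sM.gr i) →
    ∃ g : F →ₗ[K] M, IsSuperHom sF sM g ∧ ∀ x ∈ X 0 ∪ X 1, g x = f x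

end Free

end BogomolovSuper

namespace BogomolovSuper

theorem sgn_eq_one_or_neg_one (i j : ZMod 2) : sgn i j = 1 ∨ sgn i j = -1 :=
  neg_one_pow_eq_or ℤ _

/-- If all brackets of homogeneous elements are multiples of a single nonzero bracket `[p, q]`
with `p`, `q` homogeneous, then the Bogomolov multiplier is trivial. -/
theorem hasTrivialBog_of_bk_mem_span_singleton {𝕜 : Type u} [Field 𝕜] {L : Type v}
    [AddCommGroup L] [Module 𝕜 L] (s : SuperAlg 𝕜 L) {k l : ZMod 2} {p q : L}
    (hp : p ∈ s.gr k) (hq : q ∈ s.gr l) (hpq : s.bk p q ≠ 0)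
    (hbk : ∀ a b : L, s.bk a b ∈ Submodule.span 𝕜 {s.bk p q}) :
    HasTrivialBog s := by
  intro E _ _ t w hw κ hκ e he
  have hp' : p ∈ (⊤ : Submodule 𝕜 L) ⊓ s.gr k := ⟨trivial, hp⟩
  have hq' : q ∈ (⊤ : Submodule 𝕜 L) ⊓ s.gr l := ⟨trivial, hq⟩
  have hdecomp : ∀ e : E, ∃ c : 𝕜, e - c • w p q ∈ M0 s ⊤ ⊤ w ⊓ LinearMap.ker κ := by
    intro e
    have hmem : e ∈ Submodule.span 𝕜 (wedgeSet s ⊤ ⊤ w) := hw.gen ▸ trivial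
    induction hmem using Submodule.span_induction with
    | mem e h =>
      obtain ⟨i, j, a, ha, b, hb, rfl⟩ := h
      obtain ⟨c, hc⟩ := Submodule.mem_span_singleton.1 (hbk a b)
      refine ⟨c, Submodule.subset_span (Or.inl ?_), ?_⟩
      · rcases sgn_eq_one_or_neg_one k l with h | h
        · refine ⟨i, j, k, l, a, ha, b, hb, (-c) • p, Submodule.smul_mem _ _ hp', q, hq', ?_, ?_⟩
          · simp [h, ← hc]
          · rw [hw.pairing.smul_left _ k l p hp' q hq', h]
            simp [sub_eq_add_neg]
        · refine ⟨i, j, k, l, a, ha, b, hb, c • p, Submodule.smul_mem _ _ hp', q, hq', ?_, ?_⟩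
          · simp [h, ← hc]
          · rw [hw.pairing.smul_left _ k l p hp' q hq', h]
            simp [sub_eq_add_neg]
      · simp [hκ i j a ha b hb, hκ k l p hp' q hq', hc]
    | zero => exact ⟨0, by simp⟩
    | add e f _ _ he hf =>
      obtain ⟨c, hc⟩ := he
      obtain ⟨d, hd⟩ := hf
      exact ⟨c + d, by simpa only [add_smul, add_sub_add_comm] using add_mem hc hd⟩
    | smul r e _ he =>
      obtain ⟨c, hc⟩ := he
      exact ⟨r * c, by simpa only [mul_smul, smul_sub] using Submodule.smul_mem _ r hc⟩
  obtain ⟨c, hcM, hcκ⟩ := hdecomp e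
  have hc : c = 0 := by
    have h : κ e - c • κ (w p q) = 0 := by simpa using hcκ
    rw [LinearMap.mem_ker.1 he, hκ k l p hp' q hq', zero_sub, neg_eq_zero] at h
    exact (smul_eq_zero.1 h).resolve_right hpq
  simpa [hc] using hcM

/-- If a set spans, brackets lie in any submodule containing the brackets of its elements. -/
theorem bk_mem_of_span_eq_top {K : Type u} [CommRing K] {L : Type v} [AddCommGroup L]
    [Module K L] (s : SuperAlg K L) {S : Set L} (hS : Submodule.span K S = ⊤)
    {N : Submodule K L} (h : ∀ a ∈ S, ∀ b ∈ S, s.bk a b ∈ N) (a b : L) : s.bk a b ∈ N := by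
  have hle := Submodule.map₂_span_span K s.bk S S
  rw [hS] at hle
  refine (hle.le.trans (Submodule.span_le.2 ?_)) (Submodule.apply_mem_map₂ s.bk trivial trivial)
  rintro _ ⟨a, ha, b, hb, rfl⟩
  exact h a ha b hb

/-- Every special Heisenberg Lie superalgebra has trivial
Bogomolov multiplier: `B̃₀(H(m,n)) = 0` for all `m, n` with `m + n ≥ 1`.  Here
`H(m,n)` has even basis `x₁, …, x_{2m}, z`, odd basis `y₁, …, y_n`, and the only
nonzero brackets among basis elements are `[x_i, x_{m+i}] = z = -[x_{m+i}, x_i]`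
(for `i = 1, …, m`) and `[y_j, y_j] = z` (for `j = 1, …, n`). -/
theorem special_heisenberg_trivial_bogomolov
    {𝕜 : Type u} [Field 𝕜] {L : Type v} [AddCommGroup L] [Module 𝕜 L]
    (m n : ℕ) (hmn : 1 ≤ m + n) (s : SuperAlg 𝕜 L)
    (x : Fin (2 * m) → L) (y : Fin n → L) (z : L)
    (hbasis : LinearIndependent 𝕜 (Sum.elim x (Sum.elim y (fun _ : Unit => z))))
    (hspan : Submodule.span 𝕜 (Set.range x ∪ Set.range y ∪ {z}) = ⊤)
    (hgr0 : s.gr 0 = Submodule.span 𝕜 (Set.range x ∪ {z}))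
    (hgr1 : s.gr 1 = Submodule.span 𝕜 (Set.range y))
    (hxx : ∀ i j : Fin (2 * m), s.bk (x i) (x j) =
      if (j : ℕ) = (i : ℕ) + m then z else if (i : ℕ) = (j : ℕ) + m then -z else 0)
    (hxy : ∀ i j, s.bk (x i) (y j) = 0)
    (hyx : ∀ i j, s.bk (y i) (x j) = 0)
    (hyy : ∀ i j : Fin n, s.bk (y i) (y j) = if i = j then z else 0)
    (hz : ∀ l : L, s.bk z l = 0 ∧ s.bk l z = 0) :
    HasTrivialBog s := by
  have hz0 : z ≠ 0 := hbasis.ne_zero (Sum.inr (Sum.inr ()))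
  have hbk : ∀ a b : L, s.bk a b ∈ Submodule.span 𝕜 {z} := by
    have hzz : z ∈ Submodule.span 𝕜 {z} := Submodule.mem_span_singleton_self z
    refine bk_mem_of_span_eq_top s hspan ?_
    rintro a ((⟨i, rfl⟩ | ⟨i, rfl⟩) | rfl) b ((⟨j, rfl⟩ | ⟨j, rfl⟩) | rfl)
    · rw [hxx]
      split_ifs
      exacts [hzz, neg_mem hzz, zero_mem _]
    · simp [hxy]
    · simp [hz]
    · simp [hyx]
    · rw [hyy]
      split_ifs
      exacts [hzz, zero_mem _]
    all_goals simp [hz]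
  suffices h : ∃ k l : ZMod 2, ∃ p ∈ s.gr k, ∃ q ∈ s.gr l, s.bk p q = z by
    obtain ⟨k, l, p, hp, q, hq, rfl⟩ := h
    intro E _ _ t w hw
    exact hasTrivialBog_of_bk_mem_span_singleton s hp hq hz0 hbk t w hw
  rcases Nat.eq_zero_or_pos m with rfl | hm
  · have hy : y ⟨0, by omega⟩ ∈ s.gr 1 := hgr1 ▸ Submodule.subset_span ⟨_, rfl⟩
    exact ⟨1, 1, _, hy, _, hy, by simp [hyy]⟩
  · have hx : ∀ i, x i ∈ s.gr 0 := fun i => hgr0 ▸ Submodule.subset_span (Or.inl ⟨i, rfl⟩)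
    exact ⟨0, 0, _, hx ⟨0, by omega⟩, _, hx ⟨m, by omega⟩, by simp [hxx]⟩

end BogomolovSuper
end

section
/- Every trivial real Lie superalgebra L of dimension 3 with nonzero odd part has trivial Bogomolov multiplier B̃₀(L) = 0. Explicitly, B̃₀ vanishes for L(2,1) = ⟨a, b | α : [a,b]=b, [a,α]=pα, p ≠ 0⟩ and for the four families of type (1,2): ⟨a | α, β : [a,α]=α, [a,β]=pβ, 0<|p|≤1⟩; ⟨a | α, β : [a,β]=α⟩; ⟨a | α, β : [a,α]=α, [a,β]=α+β⟩; ⟨a | α, β : [a,α]=pα−β, [a,β]=α+pβ, p ≥ 0⟩. -/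
/-!
Basic definitions for Lie superalgebras over a commutative ring `K`,
graded ideals, the nonabelian (CP) exterior products and the Bogomolov multiplier.
-/

universe u v

namespace BogomolovSuper

section Helpers

variable {K : Type u} [CommRing K] {L E : Type v} [AddCommGroup L] [Module K L]
  [AddCommGroup E] [Module K E]

theorem sgn_mul_self (i j : ZMod 2) : sgn i j * sgn i j = 1 := by
  rw [sgn, ← mul_pow]
  simp

/-- Wedges of homogeneous pairs with the same bracket agree modulo `M₀(L)`. -/
theorem IsExtPairing.sub_mem_M0 {s : SuperAlg K L} {t : SuperAlg K E} {w : L → L → E}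
    (h : IsExtPairing s ⊤ ⊤ t w) {i j i' j' : ZMod 2} {m n m' n' : L}
    (hm : m ∈ s.gr i) (hn : n ∈ s.gr j) (hm' : m' ∈ s.gr i') (hn' : n' ∈ s.gr j')
    (hb : s.bk m n = s.bk m' n') : w m n - w m' n' ∈ M0 s ⊤ ⊤ w := by
  refine Submodule.subset_span (Or.inl ⟨i, j, i', j', m, ⟨trivial, hm⟩, n, ⟨trivial, hn⟩,
    ((-sgn i' j' : ℤ) : K) • m', ⟨trivial, Submodule.smul_mem _ _ hm'⟩,
    n', ⟨trivial, hn'⟩, ?_, ?_⟩)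
  · rw [map_smul, LinearMap.smul_apply, Int.cast_smul_eq_zsmul, smul_smul, mul_neg,
      sgn_mul_self, hb]
    simp
  · rw [h.smul_left _ i' j' _ ⟨trivial, hm'⟩ _ ⟨trivial, hn'⟩, Int.cast_smul_eq_zsmul,
      smul_smul, mul_neg, sgn_mul_self, neg_one_smul, sub_eq_add_neg]

theorem IsExtPairing.map_zero_left {s : SuperAlg K L} {t : SuperAlg K E} {w : L → L → E}
    (h : IsExtPairing s ⊤ ⊤ t w) {j : ZMod 2} {n : L} (hn : n ∈ s.gr j) : w 0 n = 0 := by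
  simpa using h.smul_left 0 0 j 0 ⟨trivial, zero_mem _⟩ n ⟨trivial, hn⟩

/-- A wedge of a homogeneous pair with zero bracket lies in `M₀(L)`. -/
theorem IsExtPairing.mem_M0 {s : SuperAlg K L} {t : SuperAlg K E} {w : L → L → E}
    (h : IsExtPairing s ⊤ ⊤ t w) {i j : ZMod 2} {m n : L}
    (hm : m ∈ s.gr i) (hn : n ∈ s.gr j) (hb : s.bk m n = 0) : w m n ∈ M0 s ⊤ ⊤ w := by
  simpa [h.map_zero_left hn] using
    h.sub_mem_M0 hm hn (zero_mem (s.gr 0)) hn (by simpa using hb)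

theorem IsCommMap.M0_le_ker {s : SuperAlg K L} {w : L → L → E} {κ : E →ₗ[K] L}
    (hκ : IsCommMap s ⊤ ⊤ w κ) : M0 s ⊤ ⊤ w ≤ LinearMap.ker κ := by
  refine Submodule.span_le.2 ?_
  rintro _ (⟨i, j, i', j', m, hm, n, hn, m', hm', n', hn', hb, rfl⟩ | ⟨m, hm, n, hn, hb, rfl⟩)
  · simpa [hκ i j m hm n hn, hκ i' j' m' hm' n' hn'] using hb
  · simpa [hκ 0 0 m hm n hn] using hb

/-- If the even part is spanned by two elements, and sums of mixed wedges are mixed wedges,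
then the Bogomolov multiplier vanishes as soon as `[L₁, L₁] = 0`. -/
theorem IsExtProduct.ker_le_M0 {s : SuperAlg K L} {t : SuperAlg K E} {w : L → L → E}
    (h : IsExtProduct s ⊤ ⊤ t w) {κ : E →ₗ[K] L} (hκ : IsCommMap s ⊤ ⊤ w κ)
    (htriv : ∀ u ∈ s.gr 1, ∀ v ∈ s.gr 1, s.bk u v = 0) {a b : L}
    (ha : a ∈ s.gr 0) (hb : b ∈ s.gr 0)
    (hab : ∀ x ∈ s.gr 0, ∃ p q : K, x = p • a + q • b)
    (hadd : ∀ x ∈ s.gr 0, ∀ u ∈ s.gr 1, ∀ x' ∈ s.gr 0, ∀ u' ∈ s.gr 1,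
      ∃ x'' ∈ s.gr 0, ∃ u'' ∈ s.gr 1, w x u + w x' u' = w x'' u'') :
    LinearMap.ker κ ≤ M0 s ⊤ ⊤ w := by
  have hp := h.pairing
  have key : ∀ e : E, ∃ c : K, ∃ x ∈ s.gr 0, ∃ u ∈ s.gr 1,
      e - (w (c • a) b + w x u) ∈ M0 s ⊤ ⊤ w := by
    intro e
    have he : e ∈ Submodule.span K (wedgeSet s ⊤ ⊤ w) := h.gen ▸ Submodule.mem_top
    induction he using Submodule.span_induction with
    | mem e he =>
      obtain ⟨i, j, m, ⟨-, hm⟩, n, ⟨-, hn⟩, rfl⟩ := he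
      have hz : w 0 (0 : L) = 0 := hp.map_zero_left (zero_mem (s.gr 1))
      have hzb : w 0 b = 0 := hp.map_zero_left hb
      obtain rfl | rfl : i = 0 ∨ i = 1 := (by decide : ∀ k : ZMod 2, k = 0 ∨ k = 1) i
      · obtain rfl | rfl : j = 0 ∨ j = 1 := (by decide : ∀ k : ZMod 2, k = 0 ∨ k = 1) j
        · obtain ⟨p, q, rfl⟩ := hab m hm
          obtain ⟨r, k, rfl⟩ := hab n hn
          refine ⟨p * k - q * r, 0, zero_mem _, 0, zero_mem _, ?_⟩
          rw [hz, add_zero]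
          refine hp.sub_mem_M0 hm hn (Submodule.smul_mem _ _ ha) hb ?_
          have hba : s.bk b a = -s.bk a b := by
            simpa [sgn] using s.skew 0 0 b hb a ha
          simp only [map_add, map_smul, LinearMap.add_apply, LinearMap.smul_apply,
            s.even_sq a ha, s.even_sq b hb, hba]
          module
        · exact ⟨0, m, hm, n, hn, by simp [hzb]⟩
      · obtain rfl | rfl : j = 0 ∨ j = 1 := (by decide : ∀ k : ZMod 2, k = 0 ∨ k = 1) j
        · refine ⟨0, -n, neg_mem hn, m, hm, ?_⟩
          rw [zero_smul, hzb, zero_add]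
          refine hp.sub_mem_M0 hm hn (neg_mem hn) hm ?_
          simpa [sgn] using s.skew 1 0 m hm n hn
        · refine ⟨0, 0, zero_mem _, 0, zero_mem _, ?_⟩
          simpa [hzb, hz] using hp.mem_M0 hm hn (htriv m hm n hn)
    | zero =>
      refine ⟨0, 0, zero_mem _, 0, zero_mem _, ?_⟩
      simp [hp.map_zero_left hb, hp.map_zero_left (zero_mem (s.gr 1))]
    | add e e' _ _ ih ih' =>
      obtain ⟨c, x, hx, u, hu, hz⟩ := ih
      obtain ⟨c', x', hx', u', hu', hz'⟩ := ih'
      obtain ⟨x'', hx'', u'', hu'', hs⟩ := hadd x hx u hu x' hx' u' hu'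
      refine ⟨c + c', x'', hx'', u'', hu'', ?_⟩
      rw [add_smul, hp.add_left 0 0 _ ⟨trivial, Submodule.smul_mem _ _ ha⟩ _
        ⟨trivial, Submodule.smul_mem _ _ ha⟩ _ ⟨trivial, hb⟩, ← hs]
      convert add_mem hz hz' using 1
      abel
    | smul k e _ ih =>
      obtain ⟨c, x, hx, u, hu, hz⟩ := ih
      refine ⟨k * c, k • x, Submodule.smul_mem _ _ hx, u, hu, ?_⟩
      rw [mul_smul, hp.smul_left k 0 0 _ ⟨trivial, Submodule.smul_mem _ _ ha⟩ _ ⟨trivial, hb⟩,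
        hp.smul_left k 0 1 _ ⟨trivial, hx⟩ _ ⟨trivial, hu⟩, ← smul_add, ← smul_sub]
      exact Submodule.smul_mem _ _ hz
  intro e he
  obtain ⟨c, x, hx, u, hu, hz⟩ := key e
  have hca := Submodule.smul_mem (s.gr 0) c ha
  have hsum : s.bk (c • a) b + s.bk x u = 0 := by
    have := hκ.M0_le_ker hz
    rw [LinearMap.mem_ker, map_sub, LinearMap.mem_ker.1 he, map_add,
      hκ 0 0 _ ⟨trivial, hca⟩ _ ⟨trivial, hb⟩, hκ 0 1 _ ⟨trivial, hx⟩ _ ⟨trivial, hu⟩,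
      zero_sub, neg_eq_zero] at this
    exact this
  have h0 : s.bk (c • a) b ∈ s.gr 0 := s.bk_gr 0 0 _ hca _ hb
  have h1 : s.bk x u ∈ s.gr 1 := s.bk_gr 0 1 _ hx _ hu
  have hzero : s.bk (c • a) b = 0 := by
    rw [← Submodule.mem_bot K, ← s.gr_inf]
    exact ⟨h0, by rw [eq_neg_of_add_eq_zero_left hsum]; exact neg_mem h1⟩
  have hzero' : s.bk x u = 0 := by rwa [hzero, zero_add] at hsum
  have := add_mem hz (add_mem (hp.mem_M0 hca hb hzero) (hp.mem_M0 hx hu hzero'))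
  rwa [sub_add_cancel] at this

end Helpers

theorem exists_forall_eq_smul_of_finrank_le_one {k V : Type*} [Field k] [AddCommGroup V]
    [Module k V] [FiniteDimensional k V] {p : Submodule k V} (h : Module.finrank k p ≤ 1) :
    ∃ a ∈ p, ∀ x ∈ p, ∃ c : k, x = c • a := by
  obtain ⟨a, ha⟩ := finrank_le_one_iff.1 h
  refine ⟨a, a.2, fun x hx => ?_⟩
  obtain ⟨c, hc⟩ := ha ⟨x, hx⟩
  exact ⟨c, (congrArg Subtype.val hc).symm⟩

theorem exists_forall_eq_smul_add_smul_of_finrank_le_two {k V : Type*} [Field k]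
    [AddCommGroup V] [Module k V] [FiniteDimensional k V] {p : Submodule k V}
    (h : Module.finrank k p ≤ 2) :
    ∃ a ∈ p, ∃ b ∈ p, ∀ x ∈ p, ∃ c d : k, x = c • a + d • b := by
  obtain h2 | h1 : Module.finrank k p = 2 ∨ Module.finrank k p ≤ 1 := by omega
  · let B := Module.finBasisOfFinrankEq k p h2
    refine ⟨B 0, (B 0).2, B 1, (B 1).2, fun x hx =>
      ⟨B.repr ⟨x, hx⟩ 0, B.repr ⟨x, hx⟩ 1, ?_⟩⟩
    have := congrArg Subtype.val (B.sum_repr ⟨x, hx⟩)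
    rw [Fin.sum_univ_two] at this
    exact this.symm
  · obtain ⟨a, ha, H⟩ := exists_forall_eq_smul_of_finrank_le_one h1
    refine ⟨a, ha, 0, zero_mem _, fun x hx => ?_⟩
    obtain ⟨c, hc⟩ := H x hx
    exact ⟨c, 0, by simpa using hc⟩

/-- Every trivial real Lie superalgebra `L` of dimension `3`
with nonzero odd part (i.e. `[L₁, L₁] = 0` and `L₁ ≠ 0`; by Backhouse's
classification these are exactly the algebras `L_{(2,1)}` and `L^i_{(1,2)}`,
`i = 1, …, 4`, listed in the paper) has trivial Bogomolov multiplier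
`B̃₀(L) = 0`. -/
theorem trivial_real_dim_three_trivial_bogomolov
    {L : Type v} [AddCommGroup L] [Module ℝ L] [FiniteDimensional ℝ L]
    (s : SuperAlg ℝ L)
    (hdim : Module.finrank ℝ L = 3)
    (hodd : s.gr 1 ≠ ⊥)
    (htriv : ∀ u ∈ s.gr 1, ∀ v ∈ s.gr 1, s.bk u v = 0) :
    HasTrivialBog s := by
  intro E _ _ t w hw κ hκ
  have hrank := Submodule.finrank_add_eq_of_isCompl
    (IsCompl.of_eq s.gr_inf s.gr_sup)
  rw [hdim] at hrank
  have hpos : 1 ≤ Module.finrank ℝ (s.gr 1) := Submodule.one_le_finrank_iff.2 hodd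
  obtain ⟨a, ha, b, hb, hab⟩ :=
    exists_forall_eq_smul_add_smul_of_finrank_le_two (p := s.gr 0) (by omega)
  have hp := hw.pairing
  refine hw.ker_le_M0 hκ htriv ha hb hab fun x hx u hu x' hx' u' hu' => ?_
  obtain h | h : Module.finrank ℝ (s.gr 0) ≤ 1 ∨ Module.finrank ℝ (s.gr 1) ≤ 1 := by omega
  · obtain ⟨d, hd, H⟩ := exists_forall_eq_smul_of_finrank_le_one h
    obtain ⟨c, rfl⟩ := H x hx
    obtain ⟨c', rfl⟩ := H x' hx'
    have hcu := Submodule.smul_mem (s.gr 1) c hu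
    have hcu' := Submodule.smul_mem (s.gr 1) c' hu'
    refine ⟨d, hd, c • u + c' • u', add_mem hcu hcu', ?_⟩
    rw [hp.add_right 0 1 d ⟨trivial, hd⟩ _ ⟨trivial, hcu⟩ _ ⟨trivial, hcu'⟩,
      hp.smul_left c 0 1 d ⟨trivial, hd⟩ u ⟨trivial, hu⟩,
      hp.smul_left c' 0 1 d ⟨trivial, hd⟩ u' ⟨trivial, hu'⟩,
      hp.smul_right c 0 1 d ⟨trivial, hd⟩ u ⟨trivial, hu⟩,
      hp.smul_right c' 0 1 d ⟨trivial, hd⟩ u' ⟨trivial, hu'⟩]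
  · obtain ⟨d, hd, H⟩ := exists_forall_eq_smul_of_finrank_le_one h
    obtain ⟨c, rfl⟩ := H u hu
    obtain ⟨c', rfl⟩ := H u' hu'
    have hcx := Submodule.smul_mem (s.gr 0) c hx
    have hcx' := Submodule.smul_mem (s.gr 0) c' hx'
    refine ⟨c • x + c' • x', add_mem hcx hcx', d, hd, ?_⟩
    rw [hp.add_left 0 1 _ ⟨trivial, hcx⟩ _ ⟨trivial, hcx'⟩ d ⟨trivial, hd⟩,
      hp.smul_left c 0 1 x ⟨trivial, hx⟩ d ⟨trivial, hd⟩,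
      hp.smul_left c' 0 1 x' ⟨trivial, hx'⟩ d ⟨trivial, hd⟩,
      hp.smul_right c 0 1 x ⟨trivial, hx⟩ d ⟨trivial, hd⟩,
      hp.smul_right c' 0 1 x' ⟨trivial, hx'⟩ d ⟨trivial, hd⟩]

end BogomolovSuper
end
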